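/- (Strong soundness and completeness of S3 for models with (3')) For every set of modal formulas Φ and modal formula φ: φ is derivable from Φ in the Lewis system S3 if and only if every interpretation (M,γ), where M is a model additionally satisfying (3') f□(f→(m,m')) ≤ f□(f→(f□(m),f□(m'))) for all m,m'∈M, that satisfies all formulas of Φ also satisfies φ. -/

import Mathlib

/-- Modal formulas over countably many propositional variables x₀, x₁, …. -/
inductive Fm : Type
  | var : ℕ → Fm
  | neg : Fm → Fm
  | imp : Fm → Fm → Fm
  | box : Fm → Fm
deriving DecidableEq

namespace Fm

/-- ⊤ := x₀ → x₀ -/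
def top : Fm := imp (var 0) (var 0)

/-- φ ∧ ψ := ¬(φ → ¬ψ) -/
def conj (φ ψ : Fm) : Fm := neg (imp φ (neg ψ))

/-- φ ↔ ψ := (φ → ψ) ∧ (ψ → φ) -/
def biimp (φ ψ : Fm) : Fm := conj (imp φ ψ) (imp ψ φ)

/-- strict equivalence: φ ≡ ψ := □(φ → ψ) ∧ □(ψ → φ) -/
def equiv (φ ψ : Fm) : Fm := conj (box (imp φ ψ)) (box (imp ψ φ))

/-- φ[x := ψ]: substitution of ψ for all occurrences of the variable x in φ. -/
def subst (φ : Fm) (x : ℕ) (ψ : Fm) : Fm :=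
  match φ with
  | var y => if y = x then ψ else var y
  | neg χ => neg (subst χ x ψ)
  | imp χ δ => imp (subst χ x ψ) (subst δ x ψ)
  | box χ => box (subst χ x ψ)

/-- Propositional (two-valued) evaluation of a modal formula, treating
variables and boxed formulas as atoms. -/
def pEval (v : Fm → Bool) : Fm → Bool
  | var n => v (var n)
  | neg φ => !(pEval v φ)
  | imp φ ψ => !(pEval v φ) || pEval v ψ
  | box φ => v (box φ)

/-- φ has the form of a propositional tautology, i.e. φ is a substitution
instance of a propositional tautology. -/
def isTautInstance (φ : Fm) : Prop := ∀ v : Fm → Bool, pEval v φ = true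

/-- The axioms (i)–(iii) of Lewis system S1 (Lemmon-style). -/
inductive S1Axiom : Fm → Prop
  | taut {φ} : isTautInstance φ → S1Axiom φ
  | ax2 (φ) : S1Axiom (imp (box φ) φ)
  | ax3 (φ ψ χ) :
      S1Axiom (imp (conj (box (imp φ ψ)) (box (imp ψ χ))) (box (imp φ χ)))

/-- The identity axioms (iv)–(vi), i.e. the Substitution Principle SP. -/
inductive SPAxiom : Fm → Prop
  | ax4 (φ ψ) : SPAxiom (imp (equiv φ ψ) (equiv (neg φ) (neg ψ)))
  | ax5 (φ ψ φ' ψ') :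
      SPAxiom (imp (conj (equiv φ ψ) (equiv φ' ψ'))
        (equiv (imp φ φ') (imp ψ ψ')))
  | ax6 (φ ψ) : SPAxiom (imp (equiv φ ψ) (equiv (box φ) (box ψ)))

/-- Derivability in S1+SP from a set Φ of premises: axioms (i)–(vi),
modus ponens, and Axiom Necessitation AN restricted to axioms (i)–(iii). -/
inductive S1SP : Set Fm → Fm → Prop
  | prem {Φ φ} : φ ∈ Φ → S1SP Φ φ
  | axm {Φ φ} : S1Axiom φ → S1SP Φ φ
  | spAxm {Φ φ} : SPAxiom φ → S1SP Φ φ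
  | mp {Φ φ ψ} : S1SP Φ (imp φ ψ) → S1SP Φ φ → S1SP Φ ψ
  | an {Φ φ} : S1Axiom φ → S1SP Φ (box φ)

end Fm

namespace Fm

/-- The axioms of Lewis system S3: the S1 axioms (i)–(iii) together with
the scheme (3) □(φ→ψ) → □(□φ→□ψ). -/
inductive S3Axiom : Fm → Prop
  | s1 {φ} : S1Axiom φ → S3Axiom φ
  | ax3 (φ ψ) : S3Axiom (imp (box (imp φ ψ)) (box (imp (box φ) (box ψ))))

/-- Derivability in Lewis system S3 from a set Φ of premises: axioms
(i)–(iii),(3), modus ponens, Axiom Necessitation AN applicable to all axioms,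
and Substitution of Proved Strict Equivalents SPSE. -/
inductive S3 : Set Fm → Fm → Prop
  | prem {Φ φ} : φ ∈ Φ → S3 Φ φ
  | axm {Φ φ} : S3Axiom φ → S3 Φ φ
  | mp {Φ φ ψ} : S3 Φ (imp φ ψ) → S3 Φ φ → S3 Φ ψ
  | an {Φ φ} : S3Axiom φ → S3 Φ (box φ)
  | spse {Φ} (φ : Fm) (x : ℕ) {ψ ψ'} : S3 ∅ (equiv ψ ψ') →
      S3 Φ (equiv (subst φ x ψ) (subst φ x ψ'))

end Fm

/-- An algebraic model: a Boolean algebra (with complement `ᶜ` and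
implication `⇨`), a set TRUE of true propositions, and a unary operation f□,
satisfying the model conditions (1)–(6). -/
structure MModel where
  M : Type
  [ba : BooleanAlgebra M]
  TRUE : Set M
  fbox : M → M
  bot_not_true : ⊥ ∉ TRUE
  top_true : ⊤ ∈ TRUE
  compl_true : ∀ m : M, mᶜ ∈ TRUE ↔ m ∉ TRUE
  himp_true : ∀ m m' : M, (m ⇨ m') ∈ TRUE ↔ (m ∉ TRUE ∨ m' ∈ TRUE)
  fbox_true : ∀ m : M, fbox m ∈ TRUE ↔ m = ⊤
  fbox_le : ∀ m : M, fbox m ≤ m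
  fbox_trans : ∀ m m' m'' : M,
    fbox (m ⇨ m') ⊓ fbox (m' ⇨ m'') ≤ fbox (m ⇨ m'')

attribute [instance] MModel.ba

namespace MModel

/-- The canonical homomorphic extension of an assignment γ of propositions
to the variables. -/
def eval (𝓜 : MModel) (γ : ℕ → 𝓜.M) : Fm → 𝓜.M
  | .var n => γ n
  | .neg φ => (𝓜.eval γ φ)ᶜ
  | .imp φ ψ => 𝓜.eval γ φ ⇨ 𝓜.eval γ ψ
  | .box φ => 𝓜.fbox (𝓜.eval γ φ)

/-- Satisfaction: (𝓜, γ) ⊨ φ iff γ(φ) ∈ TRUE. -/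
def sat (𝓜 : MModel) (γ : ℕ → 𝓜.M) (φ : Fm) : Prop := 𝓜.eval γ φ ∈ 𝓜.TRUE

end MModel

namespace Fm

/-- Sets of formulas containing tautologies and closed under modus ponens. -/
structure IsTheory (S : Set Fm) : Prop where
  taut : ∀ a, isTautInstance a → a ∈ S
  mp : ∀ a b, imp a b ∈ S → a ∈ S → b ∈ S

theorem IsTheory.mp2 {S : Set Fm} (h : IsTheory S) {a b c : Fm}
    (ht : isTautInstance (imp a (imp b c))) (ha : a ∈ S) (hb : b ∈ S) : c ∈ S :=
  h.mp _ _ (h.mp _ _ (h.taut _ ht) ha) hb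

theorem IsTheory.mp1 {S : Set Fm} (h : IsTheory S) {a c : Fm}
    (ht : isTautInstance (imp a c)) (ha : a ∈ S) : c ∈ S :=
  h.mp _ _ (h.taut _ ht) ha

theorem lindenbaum {N : Set Fm} (hN : IsTheory N) {a : Fm} (ha : a ∉ N) :
    ∃ v : Fm → Bool, (∀ b ∈ N, pEval v b = true) ∧ pEval v a = false := by
  classical
  obtain ⟨S, hNS, hS⟩ := zorn_subset_nonempty {S : Set Fm | IsTheory S ∧ a ∉ S} (by
    intro c hc hch hne
    refine ⟨⋃₀ c, ⟨⟨?_, ?_⟩, ?_⟩, fun s hs => Set.subset_sUnion_of_mem hs⟩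
    · intro b hb
      obtain ⟨s, hs⟩ := hne
      exact ⟨s, hs, (hc hs).1.taut b hb⟩
    · rintro x y ⟨s, hs, hxs⟩ ⟨t, ht, hxt⟩
      rcases hch.total hs ht with h | h
      · exact ⟨t, ht, (hc ht).1.mp _ _ (h hxs) hxt⟩
      · exact ⟨s, hs, (hc hs).1.mp _ _ hxs (h hxt)⟩
    · rintro ⟨s, hs, h⟩
      exact (hc hs).2 h) N ⟨hN, ha⟩
  have hT : IsTheory S := hS.prop.1
  have haS : a ∉ S := hS.prop.2
  have key : ∀ b, b ∉ S → imp b a ∈ S := by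
    intro b hb
    by_contra hba
    have hth : IsTheory {c | imp b c ∈ S} := by
      refine ⟨fun c hc => hT.taut _ ?_, fun x y hxy hx => hT.mp2 ?_ hxy hx⟩
      · intro v; simp [pEval, hc v]
      · intro v; simp only [pEval]
        cases pEval v b <;> cases pEval v x <;> cases pEval v y <;> rfl
    have hsub : S ⊆ {c | imp b c ∈ S} := by
      intro c hc
      refine hT.mp1 ?_ hc
      intro v; simp only [pEval]
      cases pEval v b <;> cases pEval v c <;> rfl
    have := hS.le_of_ge (y := {c | imp b c ∈ S}) ⟨hth, hba⟩ hsub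
    refine hb (this (hT.taut _ ?_))
    intro v; simp [pEval]
  have tr : ∀ χ, pEval (fun χ => decide (χ ∈ S)) χ = true ↔ χ ∈ S := by
    intro χ
    induction χ with
    | var n => simp [pEval]
    | box χ _ => simp [pEval]
    | neg χ ih =>
      have : pEval (fun χ => decide (χ ∈ S)) (neg χ) = true ↔ χ ∉ S := by
        rw [← ih]; simp [pEval]
      rw [this]
      constructor
      · intro h
        by_contra h2
        refine haS (hT.mp2 ?_ (key _ h) (key _ h2))
        intro v; simp only [pEval]
        cases pEval v χ <;> cases pEval v a <;> rfl
      · intro h h2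
        refine haS (hT.mp2 ?_ h h2)
        intro v; simp only [pEval]
        cases pEval v χ <;> cases pEval v a <;> rfl
    | imp x y ihx ihy =>
      have : pEval (fun χ => decide (χ ∈ S)) (imp x y) = true ↔ (x ∈ S → y ∈ S) := by
        rw [← ihx, ← ihy]; simp only [pEval]
        cases pEval (fun χ => decide (χ ∈ S)) x <;> simp
      rw [this]
      constructor
      · intro h
        by_cases hx : x ∈ S
        · refine hT.mp1 ?_ (h hx)
          intro v; simp only [pEval]
          cases pEval v x <;> cases pEval v y <;> rfl
        · by_contra h2
          refine haS (hT.mp2 ?_ (key _ hx) (key _ h2))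
          intro v; simp only [pEval]
          cases pEval v x <;> cases pEval v y <;> cases pEval v a <;> rfl
      · exact hT.mp _ _
  refine ⟨fun χ => decide (χ ∈ S), fun b hb => (tr b).2 (hNS hb), ?_⟩
  rw [← Bool.not_eq_true, tr]
  exact haS

/-- Valuations making every member of `N` true. -/
abbrev Wd (N : Set Fm) : Type := {v : Fm → Bool // ∀ b ∈ N, pEval v b = true}

/-- Truth set of a formula. -/
def ext (N : Set Fm) (a : Fm) : Set (Wd N) := {w | pEval w.1 a = true}

theorem ext_neg (N : Set Fm) (a : Fm) : ext N (neg a) = (ext N a)ᶜ := by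
  ext w; simp [ext, pEval]

theorem ext_imp (N : Set Fm) (a b : Fm) : ext N (imp a b) = (ext N a ⇨ ext N b) := by
  ext w
  rw [himp_eq]
  simp [ext, pEval, or_comm]

theorem ext_conj (N : Set Fm) (a b : Fm) : ext N (conj a b) = ext N a ⊓ ext N b := by
  ext w
  simp [ext, pEval, conj]

theorem ext_le {N : Set Fm} (hN : IsTheory N) (a b : Fm) :
    ext N a ≤ ext N b ↔ imp a b ∈ N := by
  constructor
  · intro h
    by_contra hc
    obtain ⟨v, hv, hf⟩ := lindenbaum hN hc
    have := @h ⟨v, hv⟩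
    simp only [ext, Set.mem_ofPred_eq] at this
    simp [pEval] at hf
    simp [hf] at this
  · intro h w hw
    have := w.2 _ h
    simp only [ext, Set.mem_ofPred_eq, pEval] at *
    simpa [hw] using this

theorem ext_top {N : Set Fm} (hN : IsTheory N) (a : Fm) : ext N a = ⊤ ↔ a ∈ N := by
  constructor
  · intro h
    by_contra hc
    obtain ⟨v, hv, hf⟩ := lindenbaum hN hc
    have : (⟨v, hv⟩ : Wd N) ∈ ext N a := by rw [h]; trivial
    simp [ext, hf] at this
  · intro h
    ext w
    simpa [ext] using w.2 _ h

/-- The algebra of truth sets. -/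
def alg (N : Set Fm) : BooleanSubalgebra (Set (Wd N)) where
  carrier := Set.range (ext N)
  supClosed' := by
    rintro _ ⟨a, rfl⟩ _ ⟨b, rfl⟩
    refine ⟨imp (neg a) b, ?_⟩
    rw [ext_imp, ext_neg, himp_eq, compl_compl, sup_comm]
  infClosed' := by
    rintro _ ⟨a, rfl⟩ _ ⟨b, rfl⟩
    exact ⟨conj a b, ext_conj N a b⟩
  compl_mem' := by
    rintro _ ⟨a, rfl⟩
    exact ⟨neg a, ext_neg N a⟩
  bot_mem' := ⟨conj top (neg top), by rw [ext_conj, ext_neg]; simp⟩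

/-- Truth set as element of the algebra. -/
def cls (N : Set Fm) (a : Fm) : alg N := ⟨ext N a, a, rfl⟩

theorem cls_surj (N : Set Fm) (m : alg N) : ∃ a, cls N a = m := by
  obtain ⟨_, a, rfl⟩ := m
  exact ⟨a, rfl⟩

theorem cls_neg (N : Set Fm) (a : Fm) : cls N (neg a) = (cls N a)ᶜ :=
  Subtype.ext (ext_neg N a)

theorem cls_imp (N : Set Fm) (a b : Fm) : cls N (imp a b) = (cls N a ⇨ cls N b) :=
  Subtype.ext (ext_imp N a b)

theorem cls_conj (N : Set Fm) (a b : Fm) : cls N (conj a b) = cls N a ⊓ cls N b :=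
  Subtype.ext (ext_conj N a b)

theorem cls_le {N : Set Fm} (hN : IsTheory N) (a b : Fm) :
    cls N a ≤ cls N b ↔ imp a b ∈ N := ext_le hN a b

theorem cls_top {N : Set Fm} (hN : IsTheory N) (a : Fm) : cls N a = ⊤ ↔ a ∈ N := by
  rw [← ext_top hN, Subtype.ext_iff]; rfl

/-- The box on the algebra. -/
noncomputable def bx (N : Set Fm) (m : alg N) : alg N :=
  cls N (box (Classical.choose (cls_surj N m)))

theorem bx_cls {N : Set Fm} (hN : IsTheory N)
    (hb : ∀ a b, imp a b ∈ N → imp (box a) (box b) ∈ N) (a : Fm) :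
    bx N (cls N a) = cls N (box a) := by
  have h := Classical.choose_spec (cls_surj N (cls N a))
  refine le_antisymm ((cls_le hN _ _).2 (hb _ _ ((cls_le hN _ _).1 h.le)))
    ((cls_le hN _ _).2 (hb _ _ ((cls_le hN _ _).1 h.ge)))

theorem S3_complete (Φ : Set Fm) (φ : Fm)
    (H : ∀ (𝓜 : MModel),
      (∀ m m' : 𝓜.M, 𝓜.fbox (m ⇨ m') ≤ 𝓜.fbox (𝓜.fbox m ⇨ 𝓜.fbox m')) →
      ∀ γ : ℕ → 𝓜.M, (∀ χ ∈ Φ, 𝓜.sat γ χ) → 𝓜.sat γ φ) : S3 Φ φ := by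
  by_contra hφ
  obtain ⟨v, hv, hvφ⟩ := lindenbaum (N := {a | S3 Φ a})
    ⟨fun a h => .axm (.s1 (.taut h)), fun a b h1 h2 => .mp h1 h2⟩ hφ
  have hv : ∀ b, S3 Φ b → pEval v b = true := hv
  have vmp : ∀ a b, S3 Φ (imp a b) → pEval v a = true → pEval v b = true := by
    intro a b h ha
    have := hv _ h
    simpa [pEval, ha] using this
  let N : Set Fm := {a | pEval v (box a) = true}
  have hax : ∀ a, S3Axiom a → a ∈ N := fun a h => hv _ (.an h)
  have hK : ∀ a b, imp a b ∈ N → imp (box a) (box b) ∈ N := fun a b h =>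
    vmp _ _ (.axm (.ax3 a b)) h
  have hNT : ∀ a ∈ N, pEval v a = true := fun a h => vmp _ _ (.axm (.s1 (.ax2 a))) h
  have hN : IsTheory N := by
    refine ⟨fun a h => hax _ (.s1 (.taut h)), fun a b h1 h2 => ?_⟩
    have h3 := hNT _ (hK _ _ h1)
    have h2 : pEval v (box a) = true := h2
    show pEval v (box b) = true
    rw [pEval, h2] at h3
    simpa using h3
  let w : Wd N := ⟨v, hNT⟩
  have hbx := bx_cls hN hK
  let 𝓜 : MModel :=
    { M := alg N
      TRUE := {m | w ∈ m.1}
      fbox := bx N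
      bot_not_true := fun h => h
      top_true := trivial
      compl_true := fun m => Iff.rfl
      himp_true := by
        intro m m'
        obtain ⟨a, rfl⟩ := cls_surj N m
        obtain ⟨b, rfl⟩ := cls_surj N m'
        rw [← cls_imp]
        simp [cls, ext, pEval]
      fbox_true := by
        intro m
        obtain ⟨a, rfl⟩ := cls_surj N m
        rw [hbx, cls_top hN]; rfl
      fbox_le := by
        intro m
        obtain ⟨a, rfl⟩ := cls_surj N m
        rw [hbx, cls_le hN]
        exact hax _ (.s1 (.ax2 a))
      fbox_trans := by
        intro m m' m''
        obtain ⟨a, rfl⟩ := cls_surj N m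
        obtain ⟨b, rfl⟩ := cls_surj N m'
        obtain ⟨c, rfl⟩ := cls_surj N m''
        simp only [← cls_imp, hbx, ← cls_conj]
        rw [cls_le hN]
        exact hax _ (.s1 (.ax3 a b c)) }
  have hev : ∀ χ, 𝓜.eval (fun n => cls N (var n)) χ = cls N χ := by
    intro χ
    induction χ with
    | var n => rfl
    | neg a ih => rw [MModel.eval, ih, cls_neg]
    | imp a b iha ihb => rw [MModel.eval, iha, ihb, cls_imp]
    | box a ih => rw [MModel.eval, ih, ← hbx]
  have hsat : ∀ χ, 𝓜.sat (fun n => cls N (var n)) χ ↔ pEval v χ = true := by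
    intro χ
    rw [MModel.sat, hev]; rfl
  have := (hsat φ).1 (H 𝓜 (by
    intro m m'
    obtain ⟨a, rfl⟩ := cls_surj N m
    obtain ⟨b, rfl⟩ := cls_surj N m'
    show bx N (cls N a ⇨ cls N b) ≤ bx N (bx N (cls N a) ⇨ bx N (cls N b))
    simp only [← cls_imp, hbx]
    rw [cls_le hN]
    exact hax _ (.ax3 a b)) _ (fun χ hχ => (hsat χ).2 (hv _ (.prem hχ))))
  simp [this] at hvφ

end Fm

namespace MModel

open Fm

theorem true_mono (𝓜 : MModel) {m m' : 𝓜.M} (h : m ≤ m') (hm : m ∈ 𝓜.TRUE) : m' ∈ 𝓜.TRUE := by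
  have h1 : (m ⇨ m') ∈ 𝓜.TRUE := by rw [himp_eq_top_iff.2 h]; exact 𝓜.top_true
  rcases (𝓜.himp_true _ _).1 h1 with h2 | h2
  · exact absurd hm h2
  · exact h2

theorem eval_conj (𝓜 : MModel) (γ : ℕ → 𝓜.M) (a b : Fm) :
    𝓜.eval γ (conj a b) = 𝓜.eval γ a ⊓ 𝓜.eval γ b := by
  simp [conj, eval, himp_eq, inf_comm]

theorem inf_true (𝓜 : MModel) (m m' : 𝓜.M) :
    m ⊓ m' ∈ 𝓜.TRUE ↔ m ∈ 𝓜.TRUE ∧ m' ∈ 𝓜.TRUE := by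
  have : m ⊓ m' = (m ⇨ m'ᶜ)ᶜ := by simp [himp_eq, inf_comm]
  rw [this, 𝓜.compl_true, 𝓜.himp_true, 𝓜.compl_true]
  tauto

theorem sat_equiv (𝓜 : MModel) (γ : ℕ → 𝓜.M) (a b : Fm) :
    𝓜.sat γ (equiv a b) ↔ 𝓜.eval γ a = 𝓜.eval γ b := by
  rw [sat, equiv, eval_conj, inf_true]
  simp only [eval]
  rw [𝓜.fbox_true, 𝓜.fbox_true, himp_eq_top_iff, himp_eq_top_iff, le_antisymm_iff]

theorem eval_taut (𝓜 : MModel) (γ : ℕ → 𝓜.M) {a : Fm} (h : isTautInstance a) :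
    𝓜.eval γ a = ⊤ := by
  classical
  by_contra hne
  obtain ⟨J, hJ, hIJ, hd⟩ := DistribLattice.prime_ideal_of_disjoint_filter_ideal
    (F := Order.PFilter.principal (⊤ : 𝓜.M)) (I := Order.Ideal.principal (𝓜.eval γ a)) (by
      rw [Set.disjoint_left]
      intro x hx hx2
      have h1 : ⊤ ≤ x := hx
      have h2 : x ≤ 𝓜.eval γ a := hx2
      exact hne (top_le_iff.1 (h1.trans h2)))
  have htop : (⊤ : 𝓜.M) ∉ J := fun h =>
    Set.disjoint_left.1 hd (show (⊤ : 𝓜.M) ∈ Order.PFilter.principal (⊤ : 𝓜.M) from le_refl (⊤ : 𝓜.M)) h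
  have haJ : 𝓜.eval γ a ∈ J := hIJ (show 𝓜.eval γ a ≤ 𝓜.eval γ a from le_refl _)
  have hc : ∀ m : 𝓜.M, mᶜ ∈ J ↔ m ∉ J := by
    intro m
    constructor
    · intro h1 h2
      apply htop
      rw [← sup_compl_eq_top (x := m)]
      exact Order.Ideal.sup_mem h2 h1
    · intro h1
      exact (hJ.mem_or_compl_mem).resolve_left h1
  have tr : ∀ χ, pEval (fun χ => decide (𝓜.eval γ χ ∉ J)) χ = true ↔ 𝓜.eval γ χ ∉ J := by
    intro χ
    induction χ with
    | var n => simp [pEval]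
    | box χ _ => simp [pEval]
    | neg χ ih =>
      rw [eval, hc, ← ih]; simp [pEval]
    | imp x y ihx ihy =>
      rw [eval, himp_eq, Order.Ideal.sup_mem_iff, hc, not_and_or, ← ihx, ← ihy]
      simp [pEval, or_comm]
  exact (tr a).1 (h _) haJ

theorem eval_ax (𝓜 : MModel)
    (h3 : ∀ m m' : 𝓜.M, 𝓜.fbox (m ⇨ m') ≤ 𝓜.fbox (𝓜.fbox m ⇨ 𝓜.fbox m'))
    (γ : ℕ → 𝓜.M) {a : Fm} (h : S3Axiom a) : 𝓜.eval γ a = ⊤ := by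
  rcases h with (h | a | ⟨a, b, c⟩) | ⟨a, b⟩
  · exact eval_taut 𝓜 γ h
  · exact himp_eq_top_iff.2 (𝓜.fbox_le _)
  · rw [eval, himp_eq_top_iff, eval_conj]
    exact 𝓜.fbox_trans _ _ _
  · exact himp_eq_top_iff.2 (h3 _ _)

theorem eval_subst (𝓜 : MModel) (γ : ℕ → 𝓜.M) (φ : Fm) (x : ℕ) {a b : Fm}
    (h : 𝓜.eval γ a = 𝓜.eval γ b) :
    𝓜.eval γ (subst φ x a) = 𝓜.eval γ (subst φ x b) := by
  induction φ with
  | var y => by_cases hy : y = x <;> simp [Fm.subst, hy, h]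
  | neg φ ih => simp only [Fm.subst, eval, ih]
  | imp φ ψ ih ih2 => simp only [Fm.subst, eval, ih, ih2]
  | box φ ih => simp only [Fm.subst, eval, ih]

theorem S3_sound (𝓜 : MModel)
    (h3 : ∀ m m' : 𝓜.M, 𝓜.fbox (m ⇨ m') ≤ 𝓜.fbox (𝓜.fbox m ⇨ 𝓜.fbox m'))
    (γ : ℕ → 𝓜.M) {Φ : Set Fm} {φ : Fm} (h : S3 Φ φ) :
    (∀ χ ∈ Φ, 𝓜.sat γ χ) → 𝓜.sat γ φ := by
  induction h with
  | prem h => exact fun H => H _ h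
  | axm h => intro _; rw [sat, eval_ax 𝓜 h3 γ h]; exact 𝓜.top_true
  | mp _ _ ih1 ih2 =>
    intro H
    rcases (𝓜.himp_true _ _).1 (ih1 H) with h | h
    · exact absurd (ih2 H) h
    · exact h
  | an h => intro _; exact (𝓜.fbox_true _).2 (eval_ax 𝓜 h3 γ h)
  | spse φ x _ ih =>
    intro _
    rw [sat_equiv]
    exact eval_subst 𝓜 γ φ x ((sat_equiv 𝓜 γ _ _).1 (ih (by simp)))

end MModel

open Fm in
/-- Strong soundness and completeness of S3 with respect to the class of
models additionally satisfying (3'). -/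
theorem S3_soundness_completeness (Φ : Set Fm) (φ : Fm) :
    S3 Φ φ ↔
    ∀ (𝓜 : MModel),
      (∀ m m' : 𝓜.M, 𝓜.fbox (m ⇨ m') ≤ 𝓜.fbox (𝓜.fbox m ⇨ 𝓜.fbox m')) →
      ∀ γ : ℕ → 𝓜.M, (∀ χ ∈ Φ, 𝓜.sat γ χ) → 𝓜.sat γ φ :=  by
  exact ⟨fun h 𝓜 h3 γ => 𝓜.S3_sound h3 γ h, S3_complete Φ φ⟩
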